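/- Suppose X is a Borel subset of a Polish space with its Borel σ-algebra 𝓑 and P is a weakly continuous Markov kernel. Let A, B ∈ 𝓑 be disjoint with A compact and non-simple, and let C ⊆ A be measurable, relatively open in the subspace topology of A, and contain l.a.s.(A). Then m(A\C) < ∞, and for every x ∈ X one has 0 ≤ w(x;A,B) − w(x; A\C, B) ≤ sup_{y∈C} w(y;A,B). -/

import Mathlib

open MeasureTheory ProbabilityTheory

variable {X : Type*} [MeasurableSpace X]

/-- Transition operator: `(Pf)(x) = ∫ f(y) P(x,dy)`. -/
noncomputable def transOp (P : Kernel X X) (f : X → ℝ) : X → ℝ :=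
  fun x => ∫ y, f y ∂(P x)

/-- Invariance operator `I_A f = 1_A · (Pf)`. -/
noncomputable def invOp (P : Kernel X X) (A : Set X) (f : X → ℝ) : X → ℝ :=
  A.indicator (transOp P f)

/-- Invariance value functions `u_n(·;A)`. -/
noncomputable def uN (P : Kernel X X) (A : Set X) : ℕ → X → ℝ
  | 0 => A.indicator 1
  | n + 1 => invOp P A (uN P A n)

/-- `u(x;A) = lim_n u_n(x;A)` (the sequence is pointwise nonincreasing). -/
noncomputable def uFun (P : Kernel X X) (A : Set X) : X → ℝ :=
  fun x => ⨅ n, uN P A n x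

/-- Reach-avoid value functions `w_n(·;A,B)`. -/
noncomputable def wN (P : Kernel X X) (A B : Set X) : ℕ → X → ℝ
  | 0 => B.indicator 1
  | n + 1 => fun x => B.indicator 1 x + invOp P (A \ B) (wN P A B n) x

/-- `w(x;A,B) = lim_n w_n(x;A,B)` (the sequence is pointwise nondecreasing, in `[0,1]`). -/
noncomputable def wFun (P : Kernel X X) (A B : Set X) : X → ℝ :=
  fun x => ⨆ n, wN P A B n x

/-- A bounded function. -/
def BddFun (f : X → ℝ) : Prop := ∃ C : ℝ, ∀ x, |f x| ≤ C

/-- A set `S` is absorbing if `P(x,S) = 1` for all `x ∈ S`. -/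
def Absorbing (P : Kernel X X) (S : Set X) : Prop := ∀ x ∈ S, P x S = 1

/-- A set is simple if its only absorbing measurable subset is empty. -/
def Simple (P : Kernel X X) (A : Set X) : Prop :=
  ∀ S ⊆ A, MeasurableSet S → Absorbing P S → S = ∅


/-- The kernel `P` is weakly continuous (Feller) if `Pf` is bounded upper semicontinuous
whenever `f` is bounded upper semicontinuous. -/
def WeaklyCont {X : Type*} [MeasurableSpace X] [TopologicalSpace X] (P : Kernel X X) : Prop :=
  ∀ f : X → ℝ, Measurable f → BddFun f → UpperSemicontinuous f →
    UpperSemicontinuous (transOp P f) ∧ BddFun (transOp P f)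

section Transition

lemma indicator_mem_unit {α : Type*} {A : Set α} {f : α → ℝ} (h : ∀ x, f x ∈ Set.Icc 0 1)
    (x : α) : A.indicator f x ∈ Set.Icc 0 1 := by
  by_cases hx : x ∈ A
  · simpa [hx] using h x
  · simp [hx]

variable {P : Kernel X X}

lemma measurable_transOp {f : X → ℝ} (hf : Measurable f) : Measurable (transOp P f) :=
  (hf.stronglyMeasurable.integral_kernel (κ := P)).measurable

lemma measurable_uN {A : Set X} (hA : MeasurableSet A) : ∀ n, Measurable (uN P A n)
  | 0 => measurable_one.indicator hA
  | n + 1 => (measurable_transOp (measurable_uN hA n)).indicator hA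

lemma measurable_wN {A B : Set X} (hA : MeasurableSet A) (hB : MeasurableSet B) :
    ∀ n, Measurable (wN P A B n)
  | 0 => measurable_one.indicator hB
  | n + 1 => (measurable_one.indicator hB).add
      ((measurable_transOp (measurable_wN hA hB n)).indicator (hA.diff hB))

lemma uN_eq_zero {A : Set X} {x : X} (hx : x ∉ A) (n : ℕ) : uN P A n x = 0 := by
  cases n <;> simp [uN, invOp, hx]

lemma uFun_eq_one {A : Set X} {x : X} (h : ∀ n, uN P A n x = 1) : uFun P A x = 1 := by
  simp [uFun, h]

variable [IsMarkovKernel P]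

lemma integrable_of_unit {f : X → ℝ} (hf : Measurable f) (h : ∀ x, f x ∈ Set.Icc 0 1) (x : X) :
    Integrable f (P x) :=
  Integrable.of_mem_Icc 0 1 hf.aemeasurable (.of_forall h)

lemma transOp_mem_unit {f : X → ℝ} (hf : Measurable f) (h : ∀ x, f x ∈ Set.Icc 0 1) (x : X) :
    transOp P f x ∈ Set.Icc 0 1 := by
  refine ⟨integral_nonneg fun y => (h y).1, ?_⟩
  calc transOp P f x ≤ ∫ _, (1 : ℝ) ∂(P x) :=
        integral_mono (integrable_of_unit hf h x) (integrable_const 1) fun y => (h y).2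
    _ = 1 := by simp

lemma transOp_mono {f g : X → ℝ} (hf : Measurable f) (hg : Measurable g)
    (hf' : ∀ x, f x ∈ Set.Icc 0 1) (hg' : ∀ x, g x ∈ Set.Icc 0 1) (h : ∀ x, f x ≤ g x) (x : X) :
    transOp P f x ≤ transOp P g x :=
  integral_mono (integrable_of_unit hf hf' x) (integrable_of_unit hg hg' x) h

lemma transOp_le_add_const {f g : X → ℝ} (hf : Measurable f) (hg : Measurable g)
    (hf' : ∀ x, f x ∈ Set.Icc 0 1) (hg' : ∀ x, g x ∈ Set.Icc 0 1) {M : ℝ}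
    (h : ∀ x, f x ≤ g x + M) (x : X) : transOp P f x ≤ transOp P g x + M := by
  have hgi := integrable_of_unit (P := P) hg hg' x
  calc transOp P f x ≤ ∫ y, (g y + M) ∂(P x) :=
        integral_mono (integrable_of_unit hf hf' x) (hgi.add (integrable_const M)) h
    _ = transOp P g x + M := by
        rw [integral_add hgi (integrable_const M)]
        simp [transOp]

lemma invOp_mono {A A' : Set X} (hA : A ⊆ A') {f g : X → ℝ} (hf : Measurable f)
    (hg : Measurable g) (hf' : ∀ x, f x ∈ Set.Icc 0 1) (hg' : ∀ x, g x ∈ Set.Icc 0 1)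
    (h : ∀ x, f x ≤ g x) (x : X) : invOp P A f x ≤ invOp P A' g x := by
  unfold invOp
  by_cases hx : x ∈ A
  · rw [Set.indicator_of_mem hx, Set.indicator_of_mem (hA hx)]
    exact transOp_mono hf hg hf' hg' h x
  · rw [Set.indicator_of_notMem hx]
    exact Set.indicator_nonneg (fun y _ => (transOp_mem_unit hg hg' y).1) x

/-! ### Invariance value functions -/

lemma uN_mem_unit {A : Set X} (hA : MeasurableSet A) : ∀ n x, uN P A n x ∈ Set.Icc 0 1
  | 0 => indicator_mem_unit fun _ => by simp
  | n + 1 => indicator_mem_unit (transOp_mem_unit (measurable_uN hA n) (uN_mem_unit hA n))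

lemma uN_mono {A A' : Set X} (hA : MeasurableSet A) (hA' : MeasurableSet A') (h : A ⊆ A') :
    ∀ n x, uN P A n x ≤ uN P A' n x
  | 0 => Set.indicator_le_indicator_of_subset h fun _ => zero_le_one
  | n + 1 => invOp_mono h (measurable_uN hA n) (measurable_uN hA' n) (uN_mem_unit hA n)
      (uN_mem_unit hA' n) (uN_mono hA hA' h n)

lemma uN_succ_le {A : Set X} (hA : MeasurableSet A) : ∀ n x, uN P A (n + 1) x ≤ uN P A n x
  | 0 => fun x => Set.indicator_le_indicator
      (transOp_mem_unit (measurable_uN hA 0) (uN_mem_unit hA 0) x).2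
  | n + 1 => invOp_mono subset_rfl (measurable_uN hA (n + 1)) (measurable_uN hA n)
      (uN_mem_unit hA (n + 1)) (uN_mem_unit hA n) (uN_succ_le hA n)

/-! ### Reach-avoid value functions -/

lemma wN_mem_unit {A B : Set X} (hA : MeasurableSet A) (hB : MeasurableSet B) :
    ∀ n x, wN P A B n x ∈ Set.Icc 0 1
  | 0 => indicator_mem_unit fun _ => by simp
  | n + 1 => fun x => by
      by_cases hx : x ∈ B
      · simp [wN, invOp, hx]
      · simpa [wN, hx, invOp] using indicator_mem_unit (A := A \ B)
          (transOp_mem_unit (P := P) (measurable_wN hA hB n) (wN_mem_unit hA hB n)) x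

lemma wN_mono {A A' B : Set X} (hA : MeasurableSet A) (hA' : MeasurableSet A')
    (hB : MeasurableSet B) (h : A ⊆ A') : ∀ n x, wN P A B n x ≤ wN P A' B n x
  | 0 => fun _ => le_rfl
  | n + 1 => fun x => add_le_add_right
      (invOp_mono (Set.sdiff_subset_sdiff_left h) (measurable_wN hA hB n) (measurable_wN hA' hB n)
        (wN_mem_unit hA hB n) (wN_mem_unit hA' hB n) (wN_mono hA hA' hB h n) x) _

lemma bddAbove_wN {A B : Set X} (hA : MeasurableSet A) (hB : MeasurableSet B) (x : X) :
    BddAbove (Set.range fun n => wN P A B n x) :=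
  ⟨1, Set.forall_mem_range.2 fun n => (wN_mem_unit hA hB n x).2⟩

lemma wN_le_wFun {A B : Set X} (hA : MeasurableSet A) (hB : MeasurableSet B) (n : ℕ) (x : X) :
    wN P A B n x ≤ wFun P A B x :=
  le_ciSup (bddAbove_wN hA hB x) n

lemma wFun_mem_unit {A B : Set X} (hA : MeasurableSet A) (hB : MeasurableSet B) (x : X) :
    wFun P A B x ∈ Set.Icc 0 1 :=
  ⟨(wN_mem_unit hA hB 0 x).1.trans (wN_le_wFun hA hB 0 x),
    ciSup_le fun n => (wN_mem_unit hA hB n x).2⟩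

lemma wFun_mono {A A' B : Set X} (hA : MeasurableSet A) (hA' : MeasurableSet A')
    (hB : MeasurableSet B) (h : A ⊆ A') (x : X) : wFun P A B x ≤ wFun P A' B x :=
  ciSup_mono (bddAbove_wN hA' hB x) fun n => wN_mono hA hA' hB h n x

lemma wFun_le_biSup {A B C : Set X} (hA : MeasurableSet A) (hB : MeasurableSet B) {x : X}
    (hx : x ∈ C) : wFun P A B x ≤ ⨆ y ∈ C, wFun P A B y := by
  refine (ciSup_pos (f := fun _ : x ∈ C => wFun P A B x) hx).ge.trans
    (le_ciSup (f := fun y => ⨆ _ : y ∈ C, wFun P A B y) ⟨1, ?_⟩ x)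
  exact Set.forall_mem_range.2 fun y =>
    Real.iSup_le (fun _ => (wFun_mem_unit hA hB y).2) zero_le_one

/-- Removing `C` from the safe set lowers the reach-avoid values by at most any upper bound for
the values attained on `C`. -/
lemma wN_le_wN_diff_add {A B C : Set X} (hA : MeasurableSet A) (hB : MeasurableSet B)
    (hC : MeasurableSet C) {M : ℝ} (hM : 0 ≤ M) (hCM : ∀ y ∈ C, wFun P A B y ≤ M) :
    ∀ n x, wN P A B n x ≤ wN P (A \ C) B n x + M
  | 0 => fun _ => le_add_of_nonneg_right hM
  | n + 1 => fun x => by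
      by_cases hxC : x ∈ C
      · exact ((wN_le_wFun hA hB (n + 1) x).trans (hCM x hxC)).trans
          (le_add_of_nonneg_left (wN_mem_unit (hA.diff hC) hB (n + 1) x).1)
      by_cases hx : x ∈ A \ B
      · have hx' : x ∈ (A \ C) \ B := ⟨⟨hx.1, hxC⟩, hx.2⟩
        simpa [wN, invOp, hx, hx', hx.2, hxC, hx.1] using
          transOp_le_add_const (P := P) (measurable_wN hA hB n)
            (measurable_wN (hA.diff hC) hB n) (wN_mem_unit hA hB n)
            (wN_mem_unit (hA.diff hC) hB n) (wN_le_wN_diff_add hA hB hC hM hCM n) x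
      · have hx' : x ∉ (A \ C) \ B := fun h => hx ⟨h.1.1, h.2⟩
        simp only [wN, invOp, Set.indicator_of_notMem hx, Set.indicator_of_notMem hx']
        linarith

lemma wFun_sub_wFun_diff_le {A B C : Set X} (hA : MeasurableSet A) (hB : MeasurableSet B)
    (hC : MeasurableSet C) (x : X) :
    wFun P A B x - wFun P (A \ C) B x ≤ ⨆ y ∈ C, wFun P A B y := by
  rw [sub_le_iff_le_add']
  refine ciSup_le fun n => (wN_le_wN_diff_add hA hB hC ?_
    (fun y hy => wFun_le_biSup hA hB hy) n x).trans
      (add_le_add_left (wN_le_wFun (hA.diff hC) hB n x) _)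
  exact Real.iSup_nonneg fun y => Real.iSup_nonneg fun _ => (wFun_mem_unit hA hB y).1

end Transition

section Topology

lemma UpperSemicontinuous.indicator_of_isClosed {α : Type*} [TopologicalSpace α] {K : Set α}
    (hK : IsClosed K) {g : α → ℝ} (hg : UpperSemicontinuous g) (hg0 : ∀ x, 0 ≤ g x) :
    UpperSemicontinuous (K.indicator g) := by
  intro x y hxy
  by_cases hx : x ∈ K
  · rw [Set.indicator_of_mem hx] at hxy
    filter_upwards [hg x y hxy] with z hz
    exact (Set.indicator_le_self' (fun a _ => hg0 a) z).trans_lt hz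
  · rw [Set.indicator_of_notMem hx] at hxy
    filter_upwards [hK.isOpen_compl.mem_nhds hx] with z hz
    rwa [Set.indicator_of_notMem hz]

variable {P : Kernel X X} [IsMarkovKernel P] [TopologicalSpace X] {K : Set X}

lemma upperSemicontinuous_uN (hP : WeaklyCont P) (hKm : MeasurableSet K) (hK : IsClosed K) :
    ∀ n, UpperSemicontinuous (uN P K n)
  | 0 => upperSemicontinuous_const.indicator_of_isClosed hK fun _ => zero_le_one
  | n + 1 => by
      have h := uN_mem_unit (P := P) hKm n
      exact UpperSemicontinuous.indicator_of_isClosed hK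
        (hP _ (measurable_uN hKm n) ⟨1, fun x => abs_le.2 ⟨by linarith [(h x).1], (h x).2⟩⟩
          (upperSemicontinuous_uN hP hKm hK n)).1
        fun x => (transOp_mem_unit (measurable_uN hKm n) h x).1

lemma iSup_uN_lt_one (hP : WeaklyCont P) (hKm : MeasurableSet K) (hK : IsClosed K)
    (hKc : IsCompact K) {n : ℕ} (h : ∀ x, uN P K n x < 1) : ⨆ x, uN P K n x < 1 := by
  rcases K.eq_empty_or_nonempty with rfl | hne
  · simp [uN_eq_zero (P := P) (Set.notMem_empty _) n]
  · obtain ⟨a, -, ha⟩ :=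
      ((upperSemicontinuous_uN hP hKm hK n).upperSemicontinuousOn K).exists_isMaxOn hne hKc
    have h0 := (uN_mem_unit (P := P) hKm n a).1
    refine (Real.iSup_le (fun x => ?_) h0).trans_lt (h a)
    by_cases hx : x ∈ K
    · exact ha hx
    · rwa [uN_eq_zero hx]

/-- If no point of a compact set `K` has invariance value one, then the finite-horizon invariance
values on `K` are eventually bounded away from one. -/
lemma exists_iSup_uN_lt_one (hP : WeaklyCont P) (hKm : MeasurableSet K) (hK : IsClosed K)
    (hKc : IsCompact K) (h : ∀ x ∈ K, ∃ n, uN P K n x ≠ 1) : ∃ n, ⨆ x, uN P K n x < 1 := by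
  by_contra! hcon
  have hclosed n : IsClosed {x | 1 ≤ uN P K n x} :=
    (upperSemicontinuous_uN hP hKm hK n).isClosed_preimage 1
  have hsub n : {x | 1 ≤ uN P K n x} ⊆ K := fun x hx => by
    by_contra hxK
    rw [Set.mem_ofPred_eq, uN_eq_zero hxK] at hx
    linarith
  obtain ⟨x, hx⟩ := IsCompact.nonempty_iInter_of_sequence_nonempty_isCompact_isClosed
    (fun n => {x | 1 ≤ uN P K n x})
    (fun n x (hx : 1 ≤ _) => hx.trans (uN_succ_le hKm n x))
    (fun n => by
      by_contra hne
      refine (hcon n).not_gt (iSup_uN_lt_one hP hKm hK hKc fun x => ?_)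
      by_contra! hx
      exact hne ⟨x, hx⟩)
    (hKc.of_isClosed_subset (hclosed 0) (hsub 0)) hclosed
  rw [Set.mem_iInter] at hx
  obtain ⟨n, hn⟩ := h x (hsub 0 (hx 0))
  exact hn ((uN_mem_unit hKm n x).2.antisymm (hx n))

end Topology

/-- for a weakly continuous Markov kernel on a Borel subset of a Polish space,
if `A, B` are disjoint, `A` compact and non-simple, and `C ⊆ A` is measurable, relatively open
in `A` and contains `l.a.s.(A) = {x : u(x;A) = 1}`, then `m(A\C) < ∞` and
`0 ≤ w(x;A,B) − w(x;A\C,B) ≤ sup_{y∈C} w(y;A,B)` for every `x`. -/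
theorem stmt14 {Y : Type*} [TopologicalSpace Y] [PolishSpace Y]
    [MeasurableSpace Y] [BorelSpace Y] {X₀ : Set Y} (hX₀ : MeasurableSet X₀)
    (P : Kernel ↥X₀ ↥X₀) [IsMarkovKernel P] (hP : WeaklyCont P)
    (A B C : Set ↥X₀) (hA : MeasurableSet A) (hB : MeasurableSet B) (hC : MeasurableSet C)
    (hAB : Disjoint A B) (hAcp : IsCompact A) (hAns : ¬ Simple P A)
    (hCA : C ⊆ A) (hCopen : ∃ U : Set ↥X₀, IsOpen U ∧ C = U ∩ A)
    (hlas : {x | uFun P A x = 1} ⊆ C) :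
    {k : ℕ | (⨆ x, uN P (A \ C) k x) < 1}.Nonempty ∧
      ∀ x, 0 ≤ wFun P A B x - wFun P (A \ C) B x ∧
        wFun P A B x - wFun P (A \ C) B x ≤ ⨆ y ∈ C, wFun P A B y := by
  constructor
  · obtain ⟨U, hU, rfl⟩ := hCopen
    have hK : A \ (U ∩ A) = A ∩ Uᶜ := by rw [Set.sdiff_inter_self_eq_sdiff, Set.sdiff_eq]
    refine exists_iSup_uN_lt_one hP (hA.diff hC)
      (hK ▸ hAcp.isClosed.inter hU.isClosed_compl)
      (hK ▸ hAcp.inter_right hU.isClosed_compl) fun x hx => ?_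
    by_contra! hone
    refine hx.2 (hlas (uFun_eq_one fun n => (uN_mem_unit hA n x).2.antisymm ?_))
    exact (hone n).ge.trans (uN_mono (hA.diff hC) hA Set.sdiff_subset n x)
  · exact fun x => ⟨sub_nonneg.2 (wFun_mono (hA.diff hC) hA hB Set.sdiff_subset x),
      wFun_sub_wFun_diff_le hA hB hC x⟩
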